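/- The ℤ-module ℤ is quasi coneat injective (indeed, its only coneat submodules are 0 and ℤ), but ℤ is not coneat quasi injective. -/

import Mathlib

/-!
Basic notions from the theory of coneat exact sequences.

A short exact sequence `0 → A → B → C → 0` of left `R`-modules is *coneat exact* if for every
simple right `R`-module `S` the induced map `S ⊗[R] A → S ⊗[R] B` is injective.  Since every
simple right `R`-module is isomorphic to `R ⧸ I` for a maximal right ideal `I` (realized below
as a left ideal `I : Ideal Rᵐᵒᵖ`), and since `(R ⧸ I) ⊗[R] B ≅ B ⧸ I•B` (as abelian groups,
where `I•B` is the additive subgroup generated by the products `i • b`, `i ∈ I`, `b ∈ B`),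
this is equivalent to the elementwise condition `A ∩ I•B ⊆ I•A` for every maximal right
ideal `I`, which is the formulation used here (Mathlib has no tensor product of a right module
with a left module over a noncommutative ring).
-/

universe u v

section Defs

variable (R : Type u) [Ring R]

/-- The additive subgroup of a left `R`-module `B` generated by the products `i • n` with
`i` in a right ideal `I` (realized as a left ideal of `Rᵐᵒᵖ`) and `n ∈ N`. -/
def rIdealSMul {B : Type v} [AddCommGroup B] [Module R B] (I : Ideal Rᵐᵒᵖ) (N : Set B) :
    AddSubgroup B :=
  AddSubgroup.closure {x : B | ∃ i ∈ I, ∃ n ∈ N, x = MulOpposite.unop i • n}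

/-- `A` is a *coneat submodule* of `B` : the sequence `0 → A → B → B ⧸ A → 0` remains exact
after tensoring with every simple right `R`-module, i.e. `A ∩ I•B ⊆ I•A` for every maximal
right ideal `I` of `R`. -/
def IsConeatSubmodule {B : Type v} [AddCommGroup B] [Module R B] (A : Submodule R B) : Prop :=
  ∀ I : Ideal Rᵐᵒᵖ, I.IsMaximal → ∀ a : B, a ∈ A →
    a ∈ rIdealSMul R I (Set.univ : Set B) → a ∈ rIdealSMul R I (A : Set B)

/-- The short exact sequence `0 → A –f→ B –g→ C → 0` is *coneat exact*. -/
def IsConeatExactSeq {A B C : Type v} [AddCommGroup A] [Module R A] [AddCommGroup B] [Module R B]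
    [AddCommGroup C] [Module R C] (f : A →ₗ[R] B) (g : B →ₗ[R] C) : Prop :=
  Function.Injective f ∧ Function.Surjective g ∧ Function.Exact f g ∧
    IsConeatSubmodule R (LinearMap.range f)

/-- A left `R`-module `M` is *coneat injective* if for every coneat submodule `A` of a left
`R`-module `B`, every homomorphism `A → M` extends to `B`. -/
def IsConeatInjective (M : Type v) [AddCommGroup M] [Module R M] : Prop :=
  ∀ (B : ModuleCat.{v} R) (A : Submodule R B), IsConeatSubmodule R A →
    ∀ f : A →ₗ[R] M, ∃ g : B →ₗ[R] M, g.comp A.subtype = f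

/-- `e : M → E` is a *coneat injective envelope* of `M` : `e` is injective, `E` is coneat
injective, every homomorphism from `M` to a coneat injective module factors through `e`, and
every endomorphism `f` of `E` with `f ∘ e = e` is an automorphism. -/
def IsConeatInjectiveEnvelope {M E : Type v} [AddCommGroup M] [Module R M] [AddCommGroup E]
    [Module R E] (e : M →ₗ[R] E) : Prop :=
  Function.Injective e ∧ IsConeatInjective R E ∧
    (∀ (C : ModuleCat.{v} R), IsConeatInjective R C → ∀ g : M →ₗ[R] C,
      ∃ h : E →ₗ[R] C, h.comp e = g) ∧
    (∀ f : E →ₗ[R] E, f.comp e = e → Function.Bijective f)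

/-- `M` is *`N`-coneat injective* if every homomorphism from a coneat submodule of `N`
to `M` extends to `N`. -/
def IsRelConeatInjective (M N : Type v) [AddCommGroup M] [Module R M] [AddCommGroup N]
    [Module R N] : Prop :=
  ∀ K : Submodule R N, IsConeatSubmodule R K →
    ∀ f : K →ₗ[R] M, ∃ g : N →ₗ[R] M, g.comp K.subtype = f

/-- `M` is *quasi coneat injective* if it is `M`-coneat injective. -/
def IsQuasiConeatInjective (M : Type v) [AddCommGroup M] [Module R M] : Prop :=
  IsRelConeatInjective R M M

/-- `M` is *coneat-`N`-injective* if for (some, equivalently every) coneat injective envelope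
`e : M → E`, every homomorphism `f : N → E` satisfies `f (N) ⊆ e (M)`. -/
def IsConeatRelInjective (M N : Type v) [AddCommGroup M] [Module R M] [AddCommGroup N]
    [Module R N] : Prop :=
  ∀ (E : ModuleCat.{v} R) (e : M →ₗ[R] E), IsConeatInjectiveEnvelope R e →
    ∀ f : N →ₗ[R] E, ∀ n : N, f n ∈ LinearMap.range e

/-- `M` is *coneat quasi injective* if it is coneat-`M`-injective, i.e. fully invariant in its
coneat injective envelope. -/
def IsConeatQuasiInjective (M : Type v) [AddCommGroup M] [Module R M] : Prop :=
  IsConeatRelInjective R M M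

/-- `A` is a *pure submodule* of `B` : the sequence `0 → A → B → B ⧸ A → 0` remains exact after
tensoring with every right `R`-module; elementwise (Cohn's criterion): every finite system of
linear equations `aᵢ = ∑ⱼ rᵢⱼ • xⱼ` with constants in `A` which is solvable in `B` is solvable
in `A`. -/
def IsPureSubmodule {B : Type v} [AddCommGroup B] [Module R B] (A : Submodule R B) : Prop :=
  ∀ (m n : ℕ) (r : Fin m → Fin n → R) (a : Fin m → A),
    (∃ b : Fin n → B, ∀ i, (a i : B) = ∑ j, r i j • b j) →
    ∃ a' : Fin n → A, ∀ i, (a i : B) = ∑ j, r i j • (a' j : B)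

/-- The short exact sequence `0 → A –f→ B –g→ C → 0` is *pure exact*. -/
def IsPureExactSeq {A B C : Type v} [AddCommGroup A] [Module R A] [AddCommGroup B] [Module R B]
    [AddCommGroup C] [Module R C] (f : A →ₗ[R] B) (g : B →ₗ[R] C) : Prop :=
  Function.Injective f ∧ Function.Surjective g ∧ Function.Exact f g ∧
    IsPureSubmodule R (LinearMap.range f)

/-- A left `R`-module `M` is *pure injective* if for every pure submodule `A` of a left
`R`-module `B`, every homomorphism `A → M` extends to `B`. -/
def IsPureInjective (M : Type v) [AddCommGroup M] [Module R M] : Prop :=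
  ∀ (B : ModuleCat.{v} R) (A : Submodule R B), IsPureSubmodule R A →
    ∀ f : A →ₗ[R] M, ∃ g : B →ₗ[R] M, g.comp A.subtype = f

/-- A right `R`-module `S` (i.e. a left `Rᵐᵒᵖ`-module) is *flat*, expressed through the
equational criterion (which over any ring is equivalent to `S ⊗[R] —` preserving injections):
every relation `∑ᵢ sᵢ aᵢ = 0` in `S` comes from relations in `R`. -/
def IsFlatRightModule (S : Type v) [AddCommGroup S] [Module Rᵐᵒᵖ S] : Prop :=
  ∀ (m : ℕ) (a : Fin m → R) (s : Fin m → S),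
    (∑ i, MulOpposite.op (a i) • s i) = 0 →
    ∃ (n : ℕ) (b : Fin n → Fin m → R) (t : Fin n → S),
      (∀ i, s i = ∑ j, MulOpposite.op (b j i) • t j) ∧ (∀ j, ∑ i, b j i * a i = 0)

/-- A left `R`-module `C` is *coneat flat* if `C ≅ B ⧸ A` for some coneat submodule `A ≤ B`. -/
def IsConeatFlat (C : Type v) [AddCommGroup C] [Module R C] : Prop :=
  ∃ (B : ModuleCat.{v} R) (A : Submodule R B),
    IsConeatSubmodule R A ∧ Nonempty ((B ⧸ A) ≃ₗ[R] C)

end Defs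

theorem exists_prime_eq_of_isMaximal_int_mulOpposite (I : Ideal ℤᵐᵒᵖ) (hI : I.IsMaximal) :
    ∃ p : ℕ, p.Prime ∧ ∀ i : ℤ, MulOpposite.op i ∈ I ↔ (p : ℤ) ∣ i := by
  let φ : ℤ ≃+* ℤᵐᵒᵖ := RingEquiv.toOpposite ℤ
  have hJ : (I.comap φ).IsMaximal := Ideal.comap_isMaximal_of_equiv φ
  obtain ⟨g, hg⟩ := IsPrincipalIdealRing.principal (I.comap φ)
  have hne : I.comap φ ≠ ⊥ := Ring.ne_bot_of_isMaximal_of_not_isField hJ Int.not_isField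
  have hg0 : g ≠ 0 := by
    rintro rfl
    exact hne (by simpa using hg)
  have hgp : Prime g := by
    rw [← Ideal.span_singleton_prime hg0]
    have := hJ.isPrime
    rwa [hg] at this
  refine ⟨g.natAbs, Int.prime_iff_natAbs_prime.mp hgp, fun i => ?_⟩
  rw [Int.natAbs_dvd, ← Ideal.mem_span_singleton, ← Ideal.submodule_span_eq, ← hg]
  rfl

theorem mem_rIdealSMul_int_iff {B : Type*} [AddCommGroup B] [inst : Module ℤ B] {I : Ideal ℤᵐᵒᵖ} {p : ℕ}
    (hp : ∀ i : ℤ, MulOpposite.op i ∈ I ↔ (p : ℤ) ∣ i) (A : Submodule ℤ B) (x : B) :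
    x ∈ rIdealSMul ℤ I (A : Set B) ↔ ∃ a ∈ A, x = p • a := by
  obtain rfl : inst = AddCommGroup.toIntModule B := Subsingleton.elim _ _
  constructor
  · intro hx
    induction hx using AddSubgroup.closure_induction with
    | mem x hx =>
      obtain ⟨i, hi, n, hn, rfl⟩ := hx
      obtain ⟨k, hk⟩ := (hp i.unop).1 hi
      refine ⟨_, A.smul_mem k hn, by rw [hk, mul_smul, Nat.cast_smul_eq_nsmul]⟩
    | zero => exact ⟨0, A.zero_mem, by simp⟩
    | add x y _ _ hx hy =>
      obtain ⟨a, ha, rfl⟩ := hx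
      obtain ⟨b, hb, rfl⟩ := hy
      exact ⟨a + b, A.add_mem ha hb, (nsmul_add _ _ _).symm⟩
    | neg x _ hx =>
      obtain ⟨a, ha, rfl⟩ := hx
      exact ⟨-a, A.neg_mem ha, (neg_nsmul _ _).symm⟩
  · rintro ⟨a, ha, rfl⟩
    exact AddSubgroup.subset_closure ⟨MulOpposite.op (p : ℤ), (hp p).2 dvd_rfl, a, ha,
      (Nat.cast_smul_eq_nsmul ℤ p a).symm⟩

/-- Over `ℤ`, coneat submodules are the neat subgroups: `A ∩ pB = pA` for all primes `p`. -/
theorem isConeatSubmodule_int_iff {B : Type*} [AddCommGroup B] [Module ℤ B] (A : Submodule ℤ B) :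
    IsConeatSubmodule ℤ A ↔
      ∀ p : ℕ, p.Prime → ∀ b : B, p • b ∈ A → ∃ a ∈ A, p • b = p • a := by
  constructor
  · intro h p hp b hb
    let φ : ℤᵐᵒᵖ ≃+* ℤ := (RingEquiv.toOpposite ℤ).symm
    have hpZ : Prime (p : ℤ) := Nat.prime_iff_prime_int.mp hp
    have hmax : (Ideal.span {(p : ℤ)}).IsMaximal :=
      PrincipalIdealRing.isMaximal_of_irreducible hpZ.irreducible
    have hI : ((Ideal.span {(p : ℤ)}).comap φ).IsMaximal := Ideal.comap_isMaximal_of_equiv φ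
    have hp' : ∀ i : ℤ, MulOpposite.op i ∈ (Ideal.span {(p : ℤ)}).comap φ ↔ (p : ℤ) ∣ i :=
      fun i => Ideal.mem_span_singleton
    refine (mem_rIdealSMul_int_iff hp' A _).1 (h _ hI _ hb ?_)
    exact (mem_rIdealSMul_int_iff hp' ⊤ _).2 ⟨b, trivial, rfl⟩
  · intro h I hI a ha haI
    obtain ⟨p, hp, hpI⟩ := exists_prime_eq_of_isMaximal_int_mulOpposite I hI
    obtain ⟨b, -, rfl⟩ := (mem_rIdealSMul_int_iff hpI ⊤ a).1 haI
    exact (mem_rIdealSMul_int_iff hpI A _).2 (h p hp b ha)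

theorem IsConeatSubmodule.eq_bot_or_eq_top_int {A : Submodule ℤ ℤ} (hA : IsConeatSubmodule ℤ A) :
    A = ⊥ ∨ A = ⊤ := by
  rw [isConeatSubmodule_int_iff] at hA
  obtain ⟨g, rfl⟩ := IsPrincipalIdealRing.principal A
  by_cases hg0 : g = 0
  · simp [hg0]
  right
  by_contra htop
  have hg1 : g.natAbs ≠ 1 := fun h =>
    htop (Ideal.span_singleton_eq_top.2 (Int.isUnit_iff_natAbs_eq.2 h))
  obtain ⟨p, hp, hpg⟩ := Nat.exists_prime_and_dvd hg1
  obtain ⟨k, rfl⟩ := Int.natCast_dvd.2 hpg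
  obtain ⟨a, ha, hka⟩ := hA p hp k (Submodule.mem_span_singleton_self _)
  obtain ⟨c, rfl⟩ := Submodule.mem_span_singleton.1 ha
  have hp0 : (p : ℤ) ≠ 0 := left_ne_zero_of_mul hg0
  have hk0 : k ≠ 0 := right_ne_zero_of_mul hg0
  simp only [smul_eq_mul] at hka
  have h1 : c * (p : ℤ) = 1 :=
    mul_right_cancel₀ hk0 (by rw [one_mul, mul_assoc]; exact (mul_left_cancel₀ hp0 hka).symm)
  exact (Nat.prime_iff_prime_int.mp hp).not_isUnit (IsUnit.of_mul_eq_one_right c h1)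

theorem isQuasiConeatInjective_int : IsQuasiConeatInjective ℤ ℤ := by
  intro K hK f
  rcases hK.eq_bot_or_eq_top_int with rfl | rfl
  · exact ⟨0, Subsingleton.elim _ _⟩
  · exact ⟨f.comp Submodule.topEquiv.symm.toLinearMap, by ext; rfl⟩

theorem AddMonoidHom.exists_leftInverse_of_prime_nsmul_eq_zero {G H : Type*} [AddCommGroup G]
    [AddCommGroup H] {p : ℕ} [Fact p.Prime] (hG : ∀ x : G, p • x = 0) (hH : ∀ x : H, p • x = 0)
    (j : G →+ H) (hj : Function.Injective j) : ∃ r : H →+ G, ∀ x, r (j x) = x := by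
  let : Module (ZMod p) G := AddCommGroup.zmodModule hG
  let : Module (ZMod p) H := AddCommGroup.zmodModule hH
  obtain ⟨r, hr⟩ := (j.toZModLinearMap p).exists_leftInverse_of_injective
    (LinearMap.ker_eq_bot.2 hj)
  exact ⟨r.toAddMonoidHom, LinearMap.congr_fun hr⟩

theorem AddSubgroup.exists_extend_zmod {B : Type*} [AddCommGroup B] (p : ℕ) [Fact p.Prime]
    (A : AddSubgroup B) (hA : ∀ b : B, p • b ∈ A → ∃ a ∈ A, p • b = p • a) (f : A →+ ZMod p) :
    ∃ g : B →+ ZMod p, ∀ a : A, g a = f a := by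
  let P := (nsmulAddMonoidHom p : A →+ A).range
  let Q := (nsmulAddMonoidHom p : B →+ B).range
  have hP : ∀ x : A ⧸ P, p • x = 0 := QuotientAddGroup.mk_surjective.forall.2 fun a =>
    (QuotientAddGroup.eq_zero_iff _).2 ⟨a, rfl⟩
  have hQ : ∀ x : B ⧸ Q, p • x = 0 := QuotientAddGroup.mk_surjective.forall.2 fun b =>
    (QuotientAddGroup.eq_zero_iff _).2 ⟨b, rfl⟩
  let j : A ⧸ P →+ B ⧸ Q := QuotientAddGroup.map P Q A.subtype (by
    rintro _ ⟨a, rfl⟩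
    exact ⟨a, rfl⟩)
  let fbar : A ⧸ P →+ ZMod p := QuotientAddGroup.lift P f (by
    rintro _ ⟨a, rfl⟩
    simp)
  have hj : Function.Injective j := by
    rw [injective_iff_map_eq_zero]
    refine QuotientAddGroup.mk_surjective.forall.2 fun a ha => ?_
    obtain ⟨b, hb⟩ : (a : B) ∈ Q := (QuotientAddGroup.eq_zero_iff _).1 ha
    replace hb : p • b = a := hb
    obtain ⟨a', ha', h⟩ := hA b (hb ▸ a.2)
    exact (QuotientAddGroup.eq_zero_iff _).2 ⟨⟨a', ha'⟩, Subtype.ext (h.symm.trans hb)⟩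
  obtain ⟨r, hr⟩ := j.exists_leftInverse_of_prime_nsmul_eq_zero hP hQ hj
  exact ⟨fbar.comp (r.comp (QuotientAddGroup.mk' Q)), fun a => congrArg fbar (hr (a : A ⧸ P))⟩

theorem isConeatInjective_int_zmod (p : ℕ) [Fact p.Prime] : IsConeatInjective ℤ (ZMod p) := by
  intro B A hA f
  obtain ⟨g, hg⟩ := A.toAddSubgroup.exists_extend_zmod p
    ((isConeatSubmodule_int_iff A).1 hA p Fact.out) (AddMonoidHomClass.toAddMonoidHom f)
  exact ⟨{ g with map_smul' := map_intCast_smul g ℤ ℤ }, DFunLike.ext _ _ hg⟩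

theorem IsConeatInjective.pi {R : Type*} [Ring R] {ι : Type} {M : ι → Type}
    [∀ i, AddCommGroup (M i)] [∀ i, Module R (M i)] (h : ∀ i, IsConeatInjective R (M i)) :
    IsConeatInjective R (∀ i, M i) := by
  intro B A hA f
  choose g hg using fun i => h i B A hA ((LinearMap.proj i).comp f)
  refine ⟨LinearMap.pi g, ?_⟩
  ext a i
  exact LinearMap.congr_fun (hg i) a

/-- The diagonal map `ℤ → ∏ₚ ℤ/p`. -/
def intToPiZMod : ℤ →ₗ[ℤ] (∀ p : Nat.Primes, ZMod p) :=
  LinearMap.toSpanSingleton ℤ _ 1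

@[simp]
theorem intToPiZMod_apply (n : ℤ) (p : Nat.Primes) : intToPiZMod n p = (n : ZMod p) := by
  simp [intToPiZMod]

theorem eq_zero_of_forall_prime_gt_dvd {n : ℤ} (k : ℕ)
    (h : ∀ p : ℕ, p.Prime → k ≤ p → (p : ℤ) ∣ n) : n = 0 := by
  obtain ⟨p, hp, hpp⟩ := Nat.exists_infinite_primes (max k (n.natAbs + 1))
  exact Int.eq_zero_of_dvd_of_natAbs_lt_natAbs (h p hpp (by omega)) (by simp; omega)

theorem intToPiZMod_injective : Function.Injective intToPiZMod := by
  rw [injective_iff_map_eq_zero]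
  intro n hn
  refine eq_zero_of_forall_prime_gt_dvd 0 fun p hp _ => ?_
  rw [← ZMod.intCast_zmod_eq_zero_iff_dvd]
  rw [← intToPiZMod_apply n ⟨p, hp⟩, hn]
  rfl

theorem isConeatSubmodule_range_intToPiZMod :
    IsConeatSubmodule ℤ (LinearMap.range intToPiZMod) := by
  rw [isConeatSubmodule_int_iff]
  rintro p hp b ⟨n, hn⟩
  have h : (p : ℤ) ∣ n := by
    rw [← ZMod.intCast_zmod_eq_zero_iff_dvd, ← intToPiZMod_apply n ⟨p, hp⟩, hn]
    exact ZModModule.char_nsmul_eq_zero p (b ⟨p, hp⟩ : ZMod p)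
  obtain ⟨k, rfl⟩ := h
  exact ⟨intToPiZMod k, ⟨k, rfl⟩, by rw [← hn, ← map_nsmul, nsmul_eq_mul]⟩

theorem eq_id_of_comp_intToPiZMod
    (f : (∀ p : Nat.Primes, ZMod p) →ₗ[ℤ] (∀ p : Nat.Primes, ZMod p))
    (hf : f.comp intToPiZMod = intToPiZMod) : f = LinearMap.id := by
  refine LinearMap.ext fun x => funext fun q => ?_
  have : Fact (q : ℕ).Prime := ⟨q.2⟩
  -- `x` agrees with an integer at `q`, so the difference is divisible by `q`.
  obtain ⟨n, hn⟩ := ZMod.intCast_surjective (x q)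
  obtain ⟨y, hy⟩ : ∃ y, x = intToPiZMod n + (q : ℤ) • y := by
    refine ⟨fun p => if p = q then 0 else ((q : ℕ) : ZMod p)⁻¹ * (x p - n), funext fun p => ?_⟩
    have : Fact (p : ℕ).Prime := ⟨p.2⟩
    by_cases hpq : p = q
    · subst hpq
      simp [hn]
    · have hq : ((q : ℕ) : ZMod p) ≠ 0 := by
        rw [Ne, ZMod.natCast_eq_zero_iff, Nat.prime_dvd_prime_iff_eq p.2 q.2]
        exact fun h => hpq (Subtype.ext h)
      simp [hpq, mul_inv_cancel_left₀ hq]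
  have hfn : f (intToPiZMod n) = intToPiZMod n := LinearMap.congr_fun hf n
  rw [LinearMap.id_apply, hy, map_add, map_smul, hfn]
  simp

theorem isConeatInjectiveEnvelope_intToPiZMod :
    IsConeatInjectiveEnvelope ℤ intToPiZMod := by
  refine ⟨intToPiZMod_injective, .pi fun p => ?_, fun C hC g => ?_, fun f hf => ?_⟩
  · have : Fact (p : ℕ).Prime := ⟨p.2⟩
    exact isConeatInjective_int_zmod p
  · let e := LinearEquiv.ofInjective _ intToPiZMod_injective
    obtain ⟨h, hh⟩ := hC (ModuleCat.of ℤ (∀ p : Nat.Primes, ZMod p)) _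
      isConeatSubmodule_range_intToPiZMod (g.comp e.symm.toLinearMap)
    refine ⟨h, LinearMap.ext fun n => ?_⟩
    simpa [e] using LinearMap.congr_fun hh (e n)
  · rw [eq_id_of_comp_intToPiZMod f hf]
    exact Function.bijective_id

theorem not_isConeatQuasiInjective_int : ¬ IsConeatQuasiInjective ℤ ℤ := by
  intro h
  let x : ∀ p : Nat.Primes, ZMod p := Pi.single ⟨2, Nat.prime_two⟩ 1
  obtain ⟨n, hn⟩ := h (ModuleCat.of ℤ (∀ p : Nat.Primes, ZMod p)) intToPiZMod
    isConeatInjectiveEnvelope_intToPiZMod (LinearMap.toSpanSingleton ℤ _ x) 1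
  replace hn : intToPiZMod n = x := by simpa using hn
  have hn0 : n = 0 := by
    refine eq_zero_of_forall_prime_gt_dvd 3 fun p hp hp3 => ?_
    rw [← ZMod.intCast_zmod_eq_zero_iff_dvd, ← intToPiZMod_apply n ⟨p, hp⟩, hn]
    exact Pi.single_eq_of_ne (fun h => by have := congrArg Subtype.val h; simp at this; omega) _
  have h2 := congrFun hn ⟨2, Nat.prime_two⟩
  rw [hn0, map_zero] at h2
  exact absurd (h2.trans (Pi.single_eq_same _ _)) (by decide)

/-- The `ℤ`-module `ℤ` is quasi coneat injective (indeed its only coneat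
submodules are `0` and `ℤ`), but it is not coneat quasi injective. -/
theorem int_quasiConeatInjective_not_coneatQuasiInjective :
    (∀ A : Submodule ℤ ℤ, IsConeatSubmodule ℤ A → A = ⊥ ∨ A = ⊤) ∧
    IsQuasiConeatInjective ℤ ℤ ∧ ¬ IsConeatQuasiInjective ℤ ℤ :=
  ⟨fun _ hA => hA.eq_bot_or_eq_top_int, isQuasiConeatInjective_int,
    not_isConeatQuasiInjective_int⟩
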